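/- As x → ∞, (1 − 1/2) · ∏_{2 < p ≤ x} (1 − 2/p) = 2C₂·e^{−2γ}/(ln x)² + O(1/(ln x)³), where the product runs over all odd primes p ≤ x, γ is the Euler–Mascheroni constant, and C₂ is the twin prime constant. -/

import Mathlib

open Filter Real

/-- The twin prime constant `C₂ = ∏_{p odd prime} p(p-2)/(p-1)²`. -/
noncomputable def C2 : ℝ :=
  ∏' p : {p : ℕ // p.Prime ∧ p ≠ 2}, ((p : ℕ) : ℝ) * (((p : ℕ) : ℝ) - 2) / (((p : ℕ) : ℝ) - 1) ^ 2

namespace Mertens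

open Finset Topology

/-- The weight `-log (1 - 1/p)` on the primes, extended by zero to the natural numbers. -/
noncomputable def primeWeight (n : ℕ) : ℝ := if n.Prime then -log (1 - 1 / (n : ℝ)) else 0

/-- The partial sums of `primeWeight`. -/
noncomputable def primeSum (N : ℕ) : ℝ := ∑ n ∈ range (N + 1), primeWeight n

lemma log_factorial_eq_sum (N : ℕ) :
    log (N.factorial : ℝ) = ∑ p ∈ N.primesLE, (N.factorial.factorization p : ℝ) * log p := by
  rw [log_nat_eq_sum_factorization, Finsupp.sum]
  refine sum_subset (fun p hp ↦ ?_) (fun p _ hp ↦ ?_)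
  · have hp' := Nat.support_factorization _ ▸ hp
    have hpr := Nat.prime_of_mem_primeFactors hp'
    exact Nat.mem_primesLE.2 ⟨(hpr.dvd_factorial).1 (Nat.dvd_of_mem_primeFactors hp'), hpr⟩
  · simp [Finsupp.notMem_support_iff.1 hp]

lemma sum_log_div_self_le {N : ℕ} (hN : 1 ≤ N) :
    ∑ p ∈ N.primesLE, log p / (p : ℝ) ≤ log N + log 4 := by
  have hN0 : (0 : ℝ) < N := by exact_mod_cast hN
  have hfac : log (N.factorial : ℝ) ≤ N * log N := by
    rw [← log_pow]
    exact log_le_log (by exact_mod_cast N.factorial_pos) (by exact_mod_cast N.factorial_le_pow)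
  have htheta : ∑ p ∈ N.primesLE, log (p : ℝ) ≤ log 4 * N := by
    rw [← Chebyshev.theta_eq_sum_primesLE_log]
    exact Chebyshev.theta_le_log4_mul_x hN0.le
  have key : N * ∑ p ∈ N.primesLE, log p / (p : ℝ) ≤
      ∑ p ∈ N.primesLE, ((N.factorial.factorization p : ℝ) * log p + log p) := by
    rw [mul_sum]
    refine sum_le_sum fun p hp ↦ ?_
    have hpr := Nat.prime_of_mem_primesLE hp
    have hdiv : N / p ≤ N.factorial.factorization p := by
      rw [Nat.factorization_factorial hpr (Nat.lt_succ_of_lt (Nat.lt_add_one _))]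
      refine le_trans (by simp) (single_le_sum (f := fun i ↦ N / p ^ i) (fun _ _ ↦ Nat.zero_le _)
        (Finset.mem_Ico.2 ⟨le_rfl, by omega⟩ : 1 ∈ Finset.Ico 1 (Nat.log p N + 1 + 1)))
    have hlt : (N : ℝ) / p ≤ N.factorial.factorization p + 1 := by
      have h1 : (N : ℝ) / p < (N / p : ℕ) + 1 := by
        rw [← Nat.floor_div_eq_div (K := ℝ)]; exact Nat.lt_floor_add_one _
      have h2 : ((N / p : ℕ) : ℝ) ≤ N.factorial.factorization p := by exact_mod_cast hdiv
      linarith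
    have hlog : 0 ≤ log (p : ℝ) := log_natCast_nonneg p
    calc (N : ℝ) * (log p / p) = N / p * log p := by ring
      _ ≤ (N.factorial.factorization p + 1) * log p := by gcongr
      _ = _ := by ring
  rw [sum_add_distrib, ← log_factorial_eq_sum] at key
  refine le_of_mul_le_mul_left ?_ hN0
  linarith

lemma log_sub_one_le_sum {N : ℕ} (hN : 1 ≤ N) :
    log N - 1 ≤ ∑ p ∈ N.primesLE, log p / ((p : ℝ) - 1) := by
  have hN0 : (0 : ℝ) < N := by exact_mod_cast hN
  have hfpos : (0 : ℝ) < N.factorial := by exact_mod_cast N.factorial_pos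
  have hfac : N * log N - N ≤ log (N.factorial : ℝ) := by
    have h := pow_div_factorial_le_exp (N : ℝ) hN0.le N
    have := log_le_log (by positivity) h
    rw [log_exp, log_div (by positivity) hfpos.ne', log_pow] at this
    linarith
  have key : log (N.factorial : ℝ) ≤ N * ∑ p ∈ N.primesLE, log p / ((p : ℝ) - 1) := by
    rw [log_factorial_eq_sum, mul_sum]
    refine sum_le_sum fun p hp ↦ ?_
    have hpr := Nat.prime_of_mem_primesLE hp
    have h1 : (N.factorial.factorization p : ℝ) ≤ N / ((p : ℝ) - 1) := by
      have := Nat.factorization_factorial_le_div_pred hpr N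
      calc (N.factorial.factorization p : ℝ) ≤ (N / (p - 1) : ℕ) := by exact_mod_cast this
        _ ≤ N / ((p - 1 : ℕ) : ℝ) := Nat.cast_div_le
        _ = _ := by rw [Nat.cast_sub hpr.one_le, Nat.cast_one]
    have hlog : 0 ≤ log (p : ℝ) := log_natCast_nonneg p
    calc _ ≤ N / ((p : ℝ) - 1) * log p := by gcongr
      _ = _ := by ring
  refine le_of_mul_le_mul_left ?_ hN0
  linarith

lemma neg_log_one_sub_inv_bounds {x : ℝ} (hx : 1 < x) :
    1 / x ≤ -log (1 - 1 / x) ∧ -log (1 - 1 / x) ≤ 1 / (x - 1) := by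
  have h1 : 1 / x < 1 := by rw [div_lt_one (by linarith)]; exact hx
  have hpos : 0 < 1 - 1 / x := by linarith
  constructor
  · linarith [log_le_sub_one_of_pos hpos]
  · have := one_sub_inv_le_log_of_pos hpos
    have h2 : (1 - 1 / x)⁻¹ = 1 + 1 / (x - 1) := by
      have : x - 1 ≠ 0 := by linarith
      field_simp
      ring
    linarith

lemma exists_sum_log_div_mul_pred_le :
    ∃ C : ℝ, ∀ N : ℕ, ∑ p ∈ N.primesLE, log p / ((p : ℝ) * (p - 1)) ≤ C := by
  have hs : Summable fun n : ℕ ↦ 4 * (1 / (n : ℝ) ^ (3 / 2 : ℝ)) :=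
    (summable_one_div_nat_rpow.2 (by norm_num)).mul_left 4
  refine ⟨∑' n : ℕ, 4 * (1 / (n : ℝ) ^ (3 / 2 : ℝ)), fun N ↦ ?_⟩
  refine le_trans (sum_le_sum fun p hp ↦ ?_)
    (hs.sum_le_tsum N.primesLE fun n _ ↦ by positivity)
  have hp2 : (2 : ℝ) ≤ p := by exact_mod_cast (Nat.prime_of_mem_primesLE hp).two_le
  have hp0 : (0 : ℝ) < p := by linarith
  have hlog : log (p : ℝ) ≤ 2 * (p : ℝ) ^ (1 / 2 : ℝ) := by
    have := log_le_rpow_div hp0.le (show (0 : ℝ) < 1 / 2 by norm_num)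
    linarith
  have hpow : (p : ℝ) ^ (1 / 2 : ℝ) * (p : ℝ) ^ (3 / 2 : ℝ) = p * p := by
    rw [← rpow_add hp0]; norm_num [sq]
  have h32 : (0 : ℝ) < (p : ℝ) ^ (3 / 2 : ℝ) := by positivity
  rw [mul_one_div, div_le_div_iff₀ (by nlinarith) h32]
  calc log (p : ℝ) * (p : ℝ) ^ (3 / 2 : ℝ)
      ≤ 2 * (p : ℝ) ^ (1 / 2 : ℝ) * (p : ℝ) ^ (3 / 2 : ℝ) := by gcongr
    _ = 2 * (p * p) := by rw [mul_assoc, hpow]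
    _ ≤ 4 * (p * (p - 1)) := by nlinarith

lemma sum_range_primeWeight_mul (N : ℕ) (g : ℕ → ℝ) :
    ∑ n ∈ range (N + 1), primeWeight n * g n =
      ∑ p ∈ N.primesLE, -log (1 - 1 / (p : ℝ)) * g p := by
  rw [Nat.primesLE_eq_filter_range, sum_filter]
  exact sum_congr rfl fun n _ ↦ by simp only [primeWeight, ite_mul, zero_mul]

/-- **Mertens' first theorem** for the weights `-log (1 - 1/p) * log p`. -/
lemma exists_abs_sum_primeWeight_mul_log_sub_log_le :
    ∃ K : ℝ, ∀ N : ℕ, 1 ≤ N →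
      |∑ n ∈ range (N + 1), primeWeight n * log n - log N| ≤ K := by
  obtain ⟨C, hC⟩ := exists_sum_log_div_mul_pred_le
  refine ⟨C + log 4 + 1, fun N hN ↦ ?_⟩
  have hdiff : ∑ p ∈ N.primesLE, log p / ((p : ℝ) - 1) =
      ∑ p ∈ N.primesLE, log p / (p : ℝ) + ∑ p ∈ N.primesLE, log p / ((p : ℝ) * (p - 1)) := by
    rw [← sum_add_distrib]
    refine sum_congr rfl fun p hp ↦ ?_
    have hp2 : (2 : ℝ) ≤ p := by exact_mod_cast (Nat.prime_of_mem_primesLE hp).two_le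
    have : (p : ℝ) - 1 ≠ 0 := by linarith
    field_simp
    ring
  have hb : ∀ p ∈ N.primesLE, log p / (p : ℝ) ≤ -log (1 - 1 / (p : ℝ)) * log p ∧
      -log (1 - 1 / (p : ℝ)) * log p ≤ log p / ((p : ℝ) - 1) := fun p hp ↦ by
    have hp1 : (1 : ℝ) < p := by exact_mod_cast (Nat.prime_of_mem_primesLE hp).one_lt
    have hlog : 0 ≤ log (p : ℝ) := log_natCast_nonneg p
    obtain ⟨h1, h2⟩ := neg_log_one_sub_inv_bounds hp1
    constructor
    · calc log p / (p : ℝ) = 1 / p * log p := by ring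
        _ ≤ _ := by gcongr
    · calc -log (1 - 1 / (p : ℝ)) * log p ≤ 1 / ((p : ℝ) - 1) * log p := by gcongr
        _ = _ := by ring
  rw [sum_range_primeWeight_mul N fun n ↦ log n, abs_le]
  have hlow := sum_le_sum fun p hp ↦ (hb p hp).1
  have hup := sum_le_sum fun p hp ↦ (hb p hp).2
  have h4 : 0 ≤ log (4 : ℝ) := log_nonneg (by norm_num)
  constructor
  · linarith [log_sub_one_le_sum hN, hC N]
  · linarith [sum_log_div_self_le hN, hC N]

lemma exists_abs_sub_le_of_abs_succ_sub_le {E g : ℕ → ℝ} (hg : Tendsto g atTop (𝓝 0))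
    (h : ∀ n, |E (n + 1) - E n| ≤ g n - g (n + 1)) : ∃ c, ∀ n, |E n - c| ≤ g n := by
  have hanti : Antitone g := antitone_nat_of_succ_le fun n ↦ by
    linarith [(abs_nonneg _).trans (h n)]
  have hg0 : ∀ n, 0 ≤ g n := fun n ↦ hanti.le_of_tendsto hg n
  have hup : Antitone fun n ↦ E n + g n := antitone_nat_of_succ_le fun n ↦ by
    linarith [(abs_le.1 (h n)).2]
  have hlow : Monotone fun n ↦ E n - g n := monotone_nat_of_le_succ fun n ↦ by
    linarith [(abs_le.1 (h n)).1]
  have hbdd : BddAbove (Set.range fun n ↦ E n - g n) := by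
    refine ⟨E 0 + g 0, ?_⟩
    rintro _ ⟨n, rfl⟩
    have := hup n.zero_le
    simp only at this ⊢
    linarith [hg0 n]
  have hc := tendsto_atTop_ciSup hlow hbdd
  set c := ⨆ n, E n - g n
  have hc' : Tendsto (fun n ↦ E n + g n) atTop (𝓝 c) := by
    have := (hc.add hg).add hg
    simpa using this
  refine ⟨c, fun n ↦ abs_le.2 ?_⟩
  have h1 := hup.le_of_tendsto hc' n
  have h2 := hlow.ge_of_tendsto hc n
  constructor <;> linarith

/-- **Mertens' second theorem** for the weights `-log (1 - 1/p)`, with an unspecified constant. -/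
lemma exists_abs_primeSum_sub_log_log_sub_le :
    ∃ c K : ℝ, ∀ N : ℕ, 2 ≤ N → |primeSum N - log (log N) - c| ≤ K / log N := by
  obtain ⟨K, hK⟩ := exists_abs_sum_primeWeight_mul_log_sub_log_le
  set A : ℕ → ℝ := fun N ↦ ∑ n ∈ range (N + 1), primeWeight n * log n
  set R : ℕ → ℝ := fun N ↦ A N - log N
  have hL : ∀ n : ℕ, 0 < log ((n + 2 : ℕ) : ℝ) := fun n ↦
    log_pos (by push_cast; linarith [n.cast_nonneg (α := ℝ)])
  have hK0 : 0 ≤ K := (abs_nonneg _).trans (hK 1 le_rfl)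
  have hg : Tendsto (fun n : ℕ ↦ (K + 1) / log ((n + 2 : ℕ) : ℝ)) atTop (𝓝 0) :=
    (tendsto_log_atTop.comp (tendsto_natCast_atTop_atTop.comp
      (tendsto_add_atTop_nat 2))).const_div_atTop _
  have hstep : ∀ n : ℕ, |(primeSum (n + 1 + 2) - log (log ((n + 1 + 2 : ℕ) : ℝ)) -
      R (n + 1 + 2) / log ((n + 1 + 2 : ℕ) : ℝ)) - (primeSum (n + 2) -
      log (log ((n + 2 : ℕ) : ℝ)) - R (n + 2) / log ((n + 2 : ℕ) : ℝ))| ≤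
      (K + 1) / log ((n + 2 : ℕ) : ℝ) - (K + 1) / log ((n + 1 + 2 : ℕ) : ℝ) := by
    intro n
    have hu := hL n
    have hv := hL (n + 1)
    set u := log ((n + 2 : ℕ) : ℝ) with hudef
    set v := log ((n + 1 + 2 : ℕ) : ℝ) with hvdef
    have huv : u ≤ v := log_le_log (by positivity) (by push_cast; linarith)
    have hv1 : v ≤ u + 1 := by
      have h : v - u ≤ ((n + 1 + 2 : ℕ) : ℝ) / ((n + 2 : ℕ) : ℝ) - 1 := by
        rw [hudef, hvdef, ← log_div (by positivity) (by positivity)]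
        exact log_le_sub_one_of_pos (by positivity)
      have h' : ((n + 1 + 2 : ℕ) : ℝ) / ((n + 2 : ℕ) : ℝ) ≤ 2 := by
        rw [div_le_iff₀ (by positivity)]
        push_cast
        linarith [n.cast_nonneg (α := ℝ)]
      linarith
    have hS : primeSum (n + 1 + 2) = primeSum (n + 2) + primeWeight (n + 1 + 2) := by
      rw [primeSum, primeSum, sum_range_succ]
    have hA : R (n + 1 + 2) = R (n + 2) + primeWeight (n + 1 + 2) * v - (v - u) := by
      have : A (n + 1 + 2) = A (n + 2) + primeWeight (n + 1 + 2) * v := sum_range_succ _ _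
      simp only [R, this]
      ring
    have hR := abs_le.1 (hK (n + 2) (by omega))
    change -K ≤ R (n + 2) ∧ R (n + 2) ≤ K at hR
    have hg0 : 0 ≤ 1 / u - 1 / v := sub_nonneg.2 (one_div_le_one_div_of_le hu huv)
    have hll1 : log v - log u ≤ v / u - 1 := by
      rw [← log_div hv.ne' hu.ne']
      exact log_le_sub_one_of_pos (by positivity)
    have hll2 : 1 - u / v ≤ log v - log u := by
      rw [← log_div hv.ne' hu.ne']
      have := one_sub_inv_le_log_of_pos (div_pos hv hu)
      rwa [inv_div] at this
    have hgap : v / u - 1 - (1 - u / v) ≤ 1 / u - 1 / v := by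
      have : v / u - 1 - (1 - u / v) = (v - u) * (1 / u - 1 / v) := by
        field_simp
      rw [this]
      nlinarith
    have hE : primeSum (n + 1 + 2) - log v - R (n + 1 + 2) / v -
        (primeSum (n + 2) - log u - R (n + 2) / u) =
        (1 - u / v - (log v - log u)) + R (n + 2) * (1 / u - 1 / v) := by
      rw [hS, hA]
      field_simp
      ring
    have hr1 : R (n + 2) * (1 / u - 1 / v) ≤ K * (1 / u - 1 / v) := by gcongr; exact hR.2
    have hr2 : -K * (1 / u - 1 / v) ≤ R (n + 2) * (1 / u - 1 / v) := by gcongr; exact hR.1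
    have hgoal : (K + 1) / u - (K + 1) / v = K * (1 / u - 1 / v) + (1 / u - 1 / v) := by ring
    rw [hE, hgoal, abs_le]
    constructor <;> linarith
  obtain ⟨c, hc⟩ := exists_abs_sub_le_of_abs_succ_sub_le
    (E := fun n ↦ primeSum (n + 2) - log (log ((n + 2 : ℕ) : ℝ)) -
      R (n + 2) / log ((n + 2 : ℕ) : ℝ)) hg hstep
  refine ⟨c, (K + 1) + K, fun N hN ↦ ?_⟩
  obtain ⟨n, rfl⟩ := Nat.exists_eq_add_of_le' hN
  have h1 := hc n
  have h2 : |R (n + 2) / log ((n + 2 : ℕ) : ℝ)| ≤ K / log ((n + 2 : ℕ) : ℝ) := by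
    rw [abs_div, abs_of_pos (hL n)]
    have := hL n
    gcongr
    exact hK _ (by omega)
  rw [add_div]
  refine le_trans (le_of_eq ?_) ((abs_add_le _ _).trans (add_le_add h1 h2))
  congr 1
  ring

lemma primeWeight_nonneg (n : ℕ) : 0 ≤ primeWeight n := by
  unfold primeWeight
  split_ifs with h
  · have h1 : (1 : ℝ) < n := by exact_mod_cast h.one_lt
    exact le_trans (by positivity) (neg_log_one_sub_inv_bounds h1).1
  · exact le_rfl

lemma primeWeight_le (n : ℕ) : primeWeight n ≤ 2 * (1 / (n : ℝ)) := by
  unfold primeWeight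
  split_ifs with h
  · have h2 : (2 : ℝ) ≤ n := by exact_mod_cast h.two_le
    refine (neg_log_one_sub_inv_bounds (by linarith)).2.trans ?_
    rw [mul_one_div, div_le_div_iff₀ (by linarith) (by linarith)]
    linarith
  · positivity

lemma summable_primeWeight_mul_rpow {ε : ℝ} (hε : 0 < ε) :
    Summable fun n : ℕ ↦ primeWeight n * (n : ℝ) ^ (-ε) := by
  refine Summable.of_nonneg_of_le (fun n ↦ mul_nonneg (primeWeight_nonneg n) (by positivity))
    (fun n ↦ ?_) ((summable_one_div_nat_rpow.2 (by linarith : 1 < 1 + ε)).mul_left 2)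
  rcases n.eq_zero_or_pos with rfl | hn
  · simp [primeWeight]
    positivity
  · have hn0 : (0 : ℝ) < n := by exact_mod_cast hn
    calc primeWeight n * (n : ℝ) ^ (-ε) ≤ 2 * (1 / (n : ℝ)) * (n : ℝ) ^ (-ε) := by
          gcongr
          exact primeWeight_le n
      _ = 2 * (1 / (n : ℝ) ^ (1 + ε)) := by
          rw [rpow_add hn0, rpow_neg hn0.le, rpow_one]
          field_simp

lemma abs_neg_log_one_sub_div_sub_le {x y : ℝ} (hx : 2 ≤ x) (hy0 : 0 < y) (hy1 : y ≤ 1) :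
    |-log (1 - y / x) - y * -log (1 - 1 / x)| ≤ 2 * (1 / x ^ 2) := by
  obtain ⟨h1, h2⟩ := neg_log_one_sub_inv_bounds (show 1 < x by linarith)
  have h3 : 1 < x / y := by rw [one_lt_div hy0]; linarith
  obtain ⟨h4, h5⟩ := neg_log_one_sub_inv_bounds h3
  rw [one_div_div] at h4 h5
  have h6 : 1 / (x / y - 1) ≤ y * (1 / (x - 1)) := by
    have : x / y - 1 = (x - y) / y := by field_simp
    rw [this, one_div_div, mul_one_div]
    apply div_le_div_of_nonneg_left hy0.le <;> linarith
  have h7 := mul_le_mul_of_nonneg_left h1 hy0.le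
  have h8 := mul_le_mul_of_nonneg_left h2 hy0.le
  have h9 : y * (1 / (x - 1)) - y * (1 / x) ≤ 2 * (1 / x ^ 2) := by
    have e : y * (1 / (x - 1)) - y * (1 / x) = y / (x * (x - 1)) := by
      have : x - 1 ≠ 0 := by linarith
      field_simp
      ring
    rw [e, mul_one_div, div_le_div_iff₀ (by nlinarith) (by positivity)]
    nlinarith
  have h10 : y / x = y * (1 / x) := by ring
  rw [abs_le]
  constructor <;> linarith

lemma log_riemannZeta_eq_tsum {s : ℝ} (hs : 1 < s) :
    log (riemannZeta s).re =
      ∑' n : ℕ, {p : ℕ | p.Prime}.indicator (fun n ↦ -log (1 - (n : ℝ) ^ (-s))) n := by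
  have h := riemannZeta_eulerProduct_exp_log (s := (s : ℂ)) (by simpa using hs)
  have hterm : ∀ p : Nat.Primes, -Complex.log (1 - (p : ℂ) ^ (-(s : ℂ))) =
      ((-log (1 - ((p : ℕ) : ℝ) ^ (-s)) : ℝ) : ℂ) := fun p ↦ by
    have hle : ((p : ℕ) : ℝ) ^ (-s) ≤ 1 :=
      rpow_le_one_of_one_le_of_nonpos (by exact_mod_cast p.2.one_le) (by linarith)
    rw [Complex.ofReal_neg, Complex.ofReal_log (by linarith), Complex.ofReal_sub,
      Complex.ofReal_cpow (by positivity)]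
    simp
  simp_rw [hterm] at h
  rw [← Complex.ofReal_tsum, ← Complex.ofReal_exp] at h
  rw [← h, Complex.ofReal_re, log_exp]
  exact tsum_subtype {p : ℕ | p.Prime} fun n : ℕ ↦ -log (1 - (n : ℝ) ^ (-s))

lemma summable_indicator_neg_log {s : ℝ} (hs : 1 < s) :
    Summable ({p : ℕ | p.Prime}.indicator fun n : ℕ ↦ -log (1 - (n : ℝ) ^ (-s))) := by
  refine Summable.indicator ?_ _
  have := Real.summable_log_one_add_of_summable
    ((summable_nat_rpow.2 (by linarith : -s < -1)).neg)
  simpa [sub_eq_add_neg] using this.neg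

lemma tendsto_tsum_primeWeight_mul_rpow_add_log :
    Tendsto (fun ε : ℝ ↦ ∑' n : ℕ, primeWeight n * (n : ℝ) ^ (-ε) + log ε) (𝓝[>] 0) (𝓝 0) := by
  set Z : ℝ → ℕ → ℝ := fun ε ↦
    {p : ℕ | p.Prime}.indicator fun n : ℕ ↦ -log (1 - (n : ℝ) ^ (-(1 + ε)))
  have hdom : Tendsto (fun ε : ℝ ↦ ∑' n : ℕ, (Z ε n - primeWeight n * (n : ℝ) ^ (-ε)))
      (𝓝[>] 0) (𝓝 (∑' _ : ℕ, (0 : ℝ))) := by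
    refine tendsto_tsum_of_dominated_convergence (bound := fun n : ℕ ↦ 2 * (1 / (n : ℝ) ^ 2))
      ((summable_one_div_nat_pow.2 one_lt_two).mul_left 2) (fun n ↦ ?_) ?_
    · by_cases hn : n.Prime
      · have hn1 : (1 : ℝ) < n := by exact_mod_cast hn.one_lt
        have hcont : ContinuousAt (fun ε : ℝ ↦ -log (1 - (n : ℝ) ^ (-(1 + ε))) -
            -log (1 - 1 / (n : ℝ)) * (n : ℝ) ^ (-ε)) 0 := by
          have h0 : (1 : ℝ) - (n : ℝ) ^ (-(1 + (0 : ℝ))) ≠ 0 := by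
            have : (n : ℝ) ^ (-(1 + (0 : ℝ))) < 1 := rpow_lt_one_of_one_lt_of_neg hn1 (by norm_num)
            linarith
          have h1 : (n : ℝ) ≠ 0 := by positivity
          fun_prop (disch := assumption)
        have := hcont.tendsto.mono_left (nhdsWithin_le_nhds (s := Set.Ioi 0))
        simpa [Z, primeWeight, hn, rpow_neg_one] using this
      · simp [Z, primeWeight, hn]
    · filter_upwards [self_mem_nhdsWithin] with ε hε n
      have hε0 : 0 < ε := hε
      by_cases hn : n.Prime
      · have hn2 : (2 : ℝ) ≤ n := by exact_mod_cast hn.two_le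
        have hn0 : (0 : ℝ) < n := by linarith
        have := abs_neg_log_one_sub_div_sub_le hn2 (y := (n : ℝ) ^ (-ε)) (by positivity)
          (rpow_le_one_of_one_le_of_nonpos (by linarith) (by linarith))
        have hpow : (n : ℝ) ^ (-(1 + ε)) = (n : ℝ) ^ (-ε) / n := by
          rw [neg_add, rpow_add hn0, rpow_neg_one]
          ring
        simpa only [Z, Set.indicator, Set.mem_ofPred_eq, hn, if_true, primeWeight, hpow,
          norm_eq_abs, mul_comm] using this
      · simp [Z, primeWeight, hn]
  have hshift : Tendsto (fun ε : ℝ ↦ 1 + ε) (𝓝[>] 0) (𝓝[>] 1) := by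
    refine tendsto_nhdsWithin_iff.2 ⟨?_, ?_⟩
    · have : ContinuousAt (fun ε : ℝ ↦ 1 + ε) 0 := by fun_prop
      simpa using this.tendsto.mono_left (nhdsWithin_le_nhds (s := Set.Ioi 0))
    · filter_upwards [self_mem_nhdsWithin] with ε hε
      simpa using hε
  have hzeta := ((Asymptotics.isLittleO_one_iff ℝ).1
    log_riemannZeta_add_log_sub_isLittleO_ofReal).comp hshift
  have hcomb := hzeta.sub hdom
  simp only [tsum_zero, sub_zero] at hcomb
  refine hcomb.congr' ?_
  filter_upwards [self_mem_nhdsWithin] with ε hε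
  have hε0 : 0 < ε := hε
  have hs : 1 < 1 + ε := by linarith
  rw [(summable_indicator_neg_log hs).tsum_sub (summable_primeWeight_mul_rpow hε0)]
  simp only [Function.comp_apply]
  rw [log_riemannZeta_eq_tsum hs]
  simp only [add_sub_cancel_left]
  ring

/-- The total weight of the primes `p` with `⌈log p⌉ = n`. -/
noncomputable def blockWeight (n : ℕ) : ℝ :=
  ∑ k ∈ (range (⌊exp n⌋₊ + 1)).filter (fun k : ℕ ↦ ⌈log (k : ℝ)⌉₊ = n),
    primeWeight k

lemma ceil_log_le_iff {k m : ℕ} : ⌈log (k : ℝ)⌉₊ ≤ m ↔ k ∈ range (⌊exp m⌋₊ + 1) := by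
  rw [Finset.mem_range, Nat.lt_succ_iff, Nat.le_floor_iff (exp_pos _).le, Nat.ceil_le]
  rcases k.eq_zero_or_pos with rfl | hk
  · simp [exp_nonneg]
  · exact log_le_iff_le_exp (by exact_mod_cast hk)

lemma sum_blockWeight (m : ℕ) :
    ∑ n ∈ range (m + 1), blockWeight n = primeSum ⌊exp m⌋₊ := by
  rw [primeSum, ← sum_fiberwise_of_maps_to (t := range (m + 1)) (g := fun k : ℕ ↦ ⌈log (k : ℝ)⌉₊)
    fun k hk ↦ Finset.mem_range.2 (Nat.lt_succ_of_le (ceil_log_le_iff.2 hk))]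
  refine sum_congr rfl fun n hn ↦ sum_congr ?_ fun _ _ ↦ rfl
  ext k
  simp only [Finset.mem_filter, ← ceil_log_le_iff]
  have := Finset.mem_range.1 hn
  constructor <;> rintro ⟨-, h⟩ <;> exact ⟨by omega, h⟩

lemma hasSum_blockWeight_mul_pow {z a : ℝ}
    (h : HasSum (fun k : ℕ ↦ primeWeight k * z ^ ⌈log (k : ℝ)⌉₊) a) :
    HasSum (fun n ↦ blockWeight n * z ^ n) a := by
  convert! h.tsum_fiberwise (fun k : ℕ ↦ ⌈log (k : ℝ)⌉₊) using 1
  ext n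
  rw [tsum_subtype ((fun k : ℕ ↦ ⌈log (k : ℝ)⌉₊) ⁻¹' {n})
    fun k : ℕ ↦ primeWeight k * z ^ ⌈log (k : ℝ)⌉₊, blockWeight, sum_mul,
    tsum_eq_sum (s := (range (⌊exp n⌋₊ + 1)).filter fun k : ℕ ↦ ⌈log (k : ℝ)⌉₊ = n)]
  · refine sum_congr rfl fun k hk ↦ ?_
    have hk' := (Finset.mem_filter.1 hk).2
    rw [Set.indicator_of_mem (by simpa using hk'), hk']
  · intro k hk
    refine Set.indicator_of_notMem (fun hk' ↦ hk ?_) _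
    have hk' : ⌈log (k : ℝ)⌉₊ = n := hk'
    exact Finset.mem_filter.2 ⟨ceil_log_le_iff.1 hk'.le, hk'⟩

lemma exp_neg_pow_ceil_log_bounds {ε : ℝ} (hε : 0 < ε) {k : ℕ} (hk : 0 < k) :
    exp (-ε) * (k : ℝ) ^ (-ε) ≤ exp (-ε) ^ ⌈log (k : ℝ)⌉₊ ∧
      exp (-ε) ^ ⌈log (k : ℝ)⌉₊ ≤ (k : ℝ) ^ (-ε) := by
  have hk0 : (0 : ℝ) < k := by exact_mod_cast hk
  have h1 := Nat.le_ceil (log (k : ℝ))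
  have h2 := (Nat.ceil_lt_add_one (log_natCast_nonneg k)).le
  rw [rpow_def_of_pos hk0, ← exp_add, ← exp_nat_mul, exp_le_exp, exp_le_exp]
  constructor <;> nlinarith

lemma tendsto_tsum_blockWeight_mul_pow_add_log :
    Tendsto (fun ε : ℝ ↦ ∑' n, blockWeight n * exp (-ε) ^ n + log ε) (𝓝[>] 0) (𝓝 0) ∧
      ∀ ε : ℝ, 0 < ε → Summable fun n ↦ blockWeight n * exp (-ε) ^ n := by
  have hbd : ∀ ε : ℝ, 0 < ε → ∀ k : ℕ,
      exp (-ε) * (primeWeight k * (k : ℝ) ^ (-ε)) ≤ primeWeight k * exp (-ε) ^ ⌈log (k : ℝ)⌉₊ ∧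
      primeWeight k * exp (-ε) ^ ⌈log (k : ℝ)⌉₊ ≤ primeWeight k * (k : ℝ) ^ (-ε) := by
    intro ε hε k
    rcases k.eq_zero_or_pos with rfl | hk
    · simp [primeWeight]
    · obtain ⟨h1, h2⟩ := exp_neg_pow_ceil_log_bounds hε hk
      have h0 := primeWeight_nonneg k
      refine ⟨?_, by gcongr⟩
      calc exp (-ε) * (primeWeight k * (k : ℝ) ^ (-ε))
          = primeWeight k * (exp (-ε) * (k : ℝ) ^ (-ε)) := by ring
        _ ≤ _ := by gcongr
  have hsum : ∀ ε : ℝ, 0 < ε →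
      Summable fun k : ℕ ↦ primeWeight k * exp (-ε) ^ ⌈log (k : ℝ)⌉₊ := fun ε hε ↦
    Summable.of_nonneg_of_le (fun k ↦ mul_nonneg (primeWeight_nonneg k) (by positivity))
      (fun k ↦ (hbd ε hε k).2) (summable_primeWeight_mul_rpow hε)
  refine ⟨?_, fun ε hε ↦ (hasSum_blockWeight_mul_pow (hsum ε hε).hasSum).summable⟩
  set P : ℝ → ℝ := fun ε ↦ ∑' n : ℕ, primeWeight n * (n : ℝ) ^ (-ε)
  have hP := tendsto_tsum_primeWeight_mul_rpow_add_log
  have hid : Tendsto (fun ε : ℝ ↦ ε) (𝓝[>] 0) (𝓝 0) := nhdsWithin_le_nhds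
  have hεlog : Tendsto (fun ε : ℝ ↦ ε * log ε) (𝓝[>] 0) (𝓝 0) := by
    have := (continuous_mul_log.tendsto 0).mono_left (nhdsWithin_le_nhds (s := Set.Ioi 0))
    simpa using this
  have hεP : Tendsto (fun ε : ℝ ↦ ε * P ε) (𝓝[>] 0) (𝓝 0) := by
    have := (hid.mul hP).sub hεlog
    simp only [mul_zero, sub_zero] at this
    refine this.congr fun ε ↦ ?_
    ring
  have hlow : Tendsto (fun ε : ℝ ↦ P ε + log ε - ε * P ε) (𝓝[>] 0) (𝓝 0) := by
    simpa using hP.sub hεP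
  refine tendsto_of_tendsto_of_tendsto_of_le_of_le' hlow hP ?_ ?_
  · filter_upwards [self_mem_nhdsWithin] with ε hε
    rw [(hasSum_blockWeight_mul_pow (hsum ε hε).hasSum).tsum_eq]
    have h := ((summable_primeWeight_mul_rpow hε).mul_left (exp (-ε))).tsum_le_tsum
      (fun k ↦ (hbd ε hε k).1) (hsum ε hε)
    rw [tsum_mul_left] at h
    have hP0 : 0 ≤ P ε := tsum_nonneg fun n ↦ mul_nonneg (primeWeight_nonneg n) (by positivity)
    have hexp : 1 - ε ≤ exp (-ε) := by linarith [add_one_le_exp (-ε)]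
    have := mul_le_mul_of_nonneg_right hexp hP0
    linarith
  · filter_upwards [self_mem_nhdsWithin] with ε hε
    rw [(hasSum_blockWeight_mul_pow (hsum ε hε).hasSum).tsum_eq]
    have h := (hsum ε hε).tsum_le_tsum (fun k ↦ (hbd ε hε k).2) (summable_primeWeight_mul_rpow hε)
    linarith

lemma hasSum_inv_mul_pow {z : ℝ} (hz : |z| < 1) :
    HasSum (fun n : ℕ ↦ (n : ℝ)⁻¹ * z ^ n) (-log (1 - z)) := by
  have h := hasSum_pow_div_log_of_abs_lt_one hz
  rw [← hasSum_nat_add_iff' 1]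
  simp only [range_one, sum_singleton, Nat.cast_zero, inv_zero, zero_mul, sub_zero]
  convert! h using 1
  ext n
  push_cast
  ring

lemma tendsto_log_one_sub_exp_neg_sub_log :
    Tendsto (fun ε : ℝ ↦ log (1 - exp (-ε)) - log ε) (𝓝[>] 0) (𝓝 0) := by
  have hid : Tendsto (fun ε : ℝ ↦ -ε) (𝓝[>] 0) (𝓝 0) := by
    have : ContinuousAt (fun ε : ℝ ↦ -ε) 0 := by fun_prop
    simpa using this.tendsto.mono_left (nhdsWithin_le_nhds (s := Set.Ioi 0))
  refine tendsto_of_tendsto_of_tendsto_of_le_of_le' hid tendsto_const_nhds ?_ ?_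
  · filter_upwards [self_mem_nhdsWithin] with ε hε
    have hε0 : 0 < ε := hε
    have h : ε * exp (-ε) ≤ 1 - exp (-ε) := by
      have h1 := mul_le_mul_of_nonneg_right (add_one_le_exp ε) (exp_pos (-ε)).le
      rw [← exp_add, add_neg_cancel, exp_zero] at h1
      linarith
    have := log_le_log (by positivity) h
    rw [log_mul hε0.ne' (exp_pos _).ne', log_exp] at this
    linarith
  · filter_upwards [self_mem_nhdsWithin] with ε hε
    have hε0 : 0 < ε := hε
    have h1 : exp (-ε) < 1 := exp_lt_one_iff.2 (by linarith)
    exact sub_nonpos.2 (log_le_log (by linarith) (by linarith [add_one_le_exp (-ε)]))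

lemma tendsto_exp_neg_nhdsLT_one : Tendsto (fun ε : ℝ ↦ exp (-ε)) (𝓝[>] 0) (𝓝[<] 1) := by
  refine tendsto_nhdsWithin_iff.2 ⟨?_, ?_⟩
  · have : ContinuousAt (fun ε : ℝ ↦ exp (-ε)) 0 := by fun_prop
    simpa using this.tendsto.mono_left (nhdsWithin_le_nhds (s := Set.Ioi 0))
  · filter_upwards [self_mem_nhdsWithin] with ε hε
    have hε0 : 0 < ε := hε
    exact exp_lt_one_iff.2 (by linarith)

lemma eq_zero_of_tendsto_sum_blockWeight_sub_inv {l : ℝ}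
    (h : Tendsto (fun n ↦ ∑ i ∈ range n, (blockWeight i - (i : ℝ)⁻¹)) atTop (𝓝 l)) : l = 0 := by
  have habel := (tendsto_tsum_powerSeries_nhdsWithin_lt h).comp tendsto_exp_neg_nhdsLT_one
  obtain ⟨hW, hWs⟩ := tendsto_tsum_blockWeight_mul_pow_add_log
  refine tendsto_nhds_unique habel ?_
  have := hW.add tendsto_log_one_sub_exp_neg_sub_log
  rw [add_zero] at this
  refine this.congr' ?_
  filter_upwards [self_mem_nhdsWithin] with ε hε
  have hε0 : 0 < ε := hε
  have hz : |exp (-ε)| < 1 := by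
    rw [abs_of_pos (exp_pos _)]
    exact exp_lt_one_iff.2 (by linarith)
  have hH := hasSum_inv_mul_pow hz
  simp only [Function.comp_apply, sub_mul]
  rw [(hWs ε hε).tsum_sub hH.summable, hH.tsum_eq]
  ring

lemma abs_log_floor_sub_log_le {x : ℝ} (hx : 2 ≤ x) : |log ⌊x⌋₊ - log x| ≤ 2 / x := by
  have h1 : (⌊x⌋₊ : ℝ) ≤ x := Nat.floor_le (by linarith)
  have h2 : x - 1 ≤ ⌊x⌋₊ := (Nat.sub_one_lt_floor x).le
  have h3 : (0 : ℝ) < ⌊x⌋₊ := by linarith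
  have h4 : log x - log ⌊x⌋₊ ≤ 2 / x := by
    rw [← log_div (by linarith) h3.ne']
    refine (log_le_sub_one_of_pos (by positivity)).trans ?_
    rw [sub_le_iff_le_add, div_le_iff₀ h3]
    have : (2 / x + 1) * (x - 1) ≤ (2 / x + 1) * ⌊x⌋₊ := by gcongr
    refine le_trans ?_ this
    have e : (2 / x + 1) * (x - 1) = x + 1 - 2 / x := by field_simp; ring
    have : 2 / x ≤ 1 := by rw [div_le_one (by linarith)]; exact hx
    linarith
  have h5 : log ⌊x⌋₊ ≤ log x := log_le_log h3 h1
  rw [abs_le]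
  constructor <;> linarith [show 0 ≤ 2 / x by positivity]

lemma abs_log_log_floor_sub_log_log_le {x : ℝ} (hx : 3 ≤ x) :
    |log (log ⌊x⌋₊) - log (log x)| ≤ 4 / log x := by
  have hn : (3 : ℝ) ≤ ⌊x⌋₊ := by exact_mod_cast Nat.le_floor (by exact_mod_cast hx)
  have hL1 : 1 ≤ log (⌊x⌋₊ : ℝ) := by
    rw [le_log_iff_exp_le (by linarith)]
    linarith [exp_one_lt_d9]
  have hle : log (⌊x⌋₊ : ℝ) ≤ log x := log_le_log (by linarith) (Nat.floor_le (by linarith))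
  have habs := (abs_le.1 (abs_log_floor_sub_log_le (show 2 ≤ x by linarith))).1
  have hx1 : 2 / x ≤ 2 / log x := by
    have : log x ≤ x := by linarith [log_le_sub_one_of_pos (show 0 < x by linarith)]
    gcongr
    linarith
  have hlogx : 0 < log x := by linarith
  have hup : log (log x) - log (log ⌊x⌋₊) ≤ 4 / log x := by
    rw [← log_div (by linarith) (by linarith)]
    refine (log_le_sub_one_of_pos (by positivity)).trans ?_
    have : log x / log ⌊x⌋₊ - 1 = (log x - log ⌊x⌋₊) / log ⌊x⌋₊ := by
      field_simp
    rw [this]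
    calc (log x - log ⌊x⌋₊) / log ⌊x⌋₊ ≤ log x - log ⌊x⌋₊ := div_le_self (by linarith) hL1
      _ ≤ 2 / log x := by linarith
      _ ≤ 4 / log x := by gcongr; norm_num
  have hlow : log (log ⌊x⌋₊) ≤ log (log x) := log_le_log (by linarith) hle
  rw [abs_le]
  constructor <;> linarith [show 0 ≤ 4 / log x by positivity]

/-- **Mertens' second theorem** for the weights `-log (1 - 1/p)`, with its constant. -/
lemma exists_abs_primeSum_floor_sub_le :
    ∃ K : ℝ, ∀ x : ℝ, 3 ≤ x →
      |primeSum ⌊x⌋₊ - log (log x) - eulerMascheroniConstant| ≤ K / log x := by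
  obtain ⟨c, K, hK⟩ := exists_abs_primeSum_sub_log_log_sub_le
  have hK0 : 0 ≤ K := by
    have h := (abs_nonneg _).trans (hK 2 le_rfl)
    have hlog : 0 < log ((2 : ℕ) : ℝ) := log_pos (by norm_num)
    by_contra hneg
    linarith [div_neg_of_neg_of_pos (not_le.1 hneg) hlog]
  have hreal : ∀ x : ℝ, 3 ≤ x →
      |primeSum ⌊x⌋₊ - log (log x) - c| ≤ (2 * K + 4) / log x := fun x hx ↦ by
    have hn : 3 ≤ ⌊x⌋₊ := Nat.le_floor (by exact_mod_cast hx)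
    have hn' : (3 : ℝ) ≤ ⌊x⌋₊ := by exact_mod_cast hn
    have hlogx : 0 < log x := log_pos (by linarith)
    have hlogn : 0 < log (⌊x⌋₊ : ℝ) := log_pos (by linarith)
    have h1 := hK ⌊x⌋₊ (by omega)
    have h2 := abs_log_log_floor_sub_log_log_le hx
    have hhalf : K / log ⌊x⌋₊ ≤ 2 * K / log x := by
      rw [div_le_div_iff₀ hlogn hlogx]
      have : log x ≤ 2 * log ⌊x⌋₊ := by
        rw [← log_rpow (by linarith)]
        refine log_le_log (by linarith) ?_
        rw [rpow_two]
        nlinarith [Nat.lt_floor_add_one x]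
      nlinarith
    rw [add_div]
    refine le_trans (le_of_eq ?_) ((abs_add_le _ _).trans (add_le_add (h1.trans hhalf) h2))
    congr 1
    ring
  have hc : c = eulerMascheroniConstant := by
    refine sub_eq_zero.1 (eq_zero_of_tendsto_sum_blockWeight_sub_inv
      ((tendsto_add_atTop_iff_nat 1).1 ?_))
    have hcast := tendsto_natCast_atTop_atTop (R := ℝ)
    have hS : Tendsto (fun n : ℕ ↦ primeSum ⌊exp n⌋₊ - log n - c) atTop (𝓝 0) := by
      refine squeeze_zero_norm' ?_ (hcast.const_div_atTop (2 * K + 4))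
      filter_upwards [(tendsto_exp_atTop.comp hcast).eventually_ge_atTop 3] with n hn
      simpa using hreal (exp n) hn
    have := (hS.sub tendsto_harmonic_sub_log).add_const c
    rw [zero_sub, neg_add_eq_sub] at this
    refine this.congr fun n ↦ ?_
    rw [sum_sub_distrib, sum_blockWeight, harmonic, Finset.sum_range_succ']
    push_cast
    ring
  exact ⟨2 * K + 4, hc ▸ hreal⟩

/-- The partial products of the twin prime constant. -/
noncomputable def twinPartial (N : ℕ) : ℝ :=
  ∏ p ∈ (Finset.Icc 3 N).filter Nat.Prime, (p : ℝ) * ((p : ℝ) - 2) / ((p : ℝ) - 1) ^ 2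

lemma prod_filter_prime_Icc_succ (f : ℕ → ℝ) {N : ℕ} (hN : 2 ≤ N) :
    ∏ p ∈ (Finset.Icc 3 (N + 1)).filter Nat.Prime, f p =
      (∏ p ∈ (Finset.Icc 3 N).filter Nat.Prime, f p) *
        if (N + 1).Prime then f (N + 1) else 1 := by
  rw [prod_filter, prod_filter, Finset.prod_Icc_succ_top (by omega)]

lemma twin_factor_eq {x : ℝ} (hx : x ≠ 1) : x * (x - 2) / (x - 1) ^ 2 = 1 + -(1 / (x - 1) ^ 2) := by
  have : x - 1 ≠ 0 := sub_ne_zero.2 hx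
  field_simp
  ring

lemma hasProd_C2 :
    HasProd ({p : ℕ | p.Prime ∧ p ≠ 2}.mulIndicator
      fun n : ℕ ↦ (n : ℝ) * ((n : ℝ) - 2) / ((n : ℝ) - 1) ^ 2) C2 := by
  rw [← hasProd_subtype_iff_mulIndicator]
  refine Multipliable.hasProd (f := fun p : {p : ℕ // p.Prime ∧ p ≠ 2} ↦
    ((p : ℕ) : ℝ) * (((p : ℕ) : ℝ) - 2) / (((p : ℕ) : ℝ) - 1) ^ 2) ?_
  have hone : ∀ p : {p : ℕ // p.Prime ∧ p ≠ 2}, (1 : ℝ) < (p : ℕ) := fun p ↦ by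
    exact_mod_cast p.2.1.one_lt
  simp_rw [fun p : {p : ℕ // p.Prime ∧ p ≠ 2} ↦ twin_factor_eq (hone p).ne']
  refine Real.multipliable_one_add_of_summable (Summable.neg ?_)
  have hs : Summable fun n : ℕ ↦ 4 * (1 / (n : ℝ) ^ 2) :=
    (summable_one_div_nat_pow.2 one_lt_two).mul_left 4
  refine Summable.of_nonneg_of_le (fun p ↦ by positivity) (fun p ↦ ?_)
    (hs.comp_injective Subtype.val_injective)
  have hp2 : (2 : ℝ) ≤ (p : ℕ) := by exact_mod_cast p.2.1.two_le
  have hpos : (0 : ℝ) < (p : ℕ) - 1 := by linarith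
  simp only [Function.comp_apply]
  rw [mul_one_div, div_le_div_iff₀ (by positivity) (by positivity)]
  nlinarith

lemma tendsto_twinPartial : Tendsto twinPartial atTop (𝓝 C2) := by
  refine ((tendsto_add_atTop_iff_nat 1).2 hasProd_C2.tendsto_prod_nat).congr fun N ↦ ?_
  rw [twinPartial, ← prod_subset (s₁ := (Finset.Icc 3 N).filter Nat.Prime) (s₂ := range (N + 1))]
  · refine prod_congr rfl fun p hp ↦ ?_
    obtain ⟨hp1, hp2⟩ := Finset.mem_filter.1 hp
    rw [Set.mulIndicator_of_mem]
    exact ⟨hp2, by have := (Finset.mem_Icc.1 hp1).1; omega⟩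
  · intro p hp
    have := (Finset.mem_Icc.1 (Finset.mem_filter.1 hp).1).2
    exact Finset.mem_range.2 (by omega)
  · intro p hp hp'
    refine Set.mulIndicator_of_notMem (fun hmem ↦ hp' ?_) _
    obtain ⟨h1, h2⟩ := hmem
    have h3 := h1.two_le
    have h4 := Finset.mem_range.1 hp
    exact Finset.mem_filter.2 ⟨Finset.mem_Icc.2 ⟨by omega, by omega⟩, h1⟩

lemma twinPartial_bounds {N : ℕ} (hN : 2 ≤ N) :
    0 ≤ twinPartial N ∧ twinPartial N ≤ 1 ∧ |twinPartial N - C2| ≤ 1 / N := by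
  have hfac : ∀ n : ℕ, 2 ≤ n →
      1 - 1 / (n : ℝ) ^ 2 ≤ (if (n + 1).Prime then
        ((n + 1 : ℕ) : ℝ) * (((n + 1 : ℕ) : ℝ) - 2) / (((n + 1 : ℕ) : ℝ) - 1) ^ 2 else 1) ∧
      (if (n + 1).Prime then
        ((n + 1 : ℕ) : ℝ) * (((n + 1 : ℕ) : ℝ) - 2) / (((n + 1 : ℕ) : ℝ) - 1) ^ 2 else 1) ≤ 1 := by
    intro n hn
    have hn2 : (2 : ℝ) ≤ n := by exact_mod_cast hn
    have hpos : 0 ≤ 1 / (n : ℝ) ^ 2 := by positivity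
    split_ifs
    · rw [twin_factor_eq (by push_cast; linarith)]
      push_cast
      rw [add_sub_cancel_right]
      constructor <;> linarith
    · constructor <;> linarith
  have hsucc : ∀ n : ℕ, 2 ≤ n → twinPartial (n + 1) = twinPartial n * _ := fun n hn ↦
    prod_filter_prime_Icc_succ (fun n : ℕ ↦ (n : ℝ) * ((n : ℝ) - 2) / ((n : ℝ) - 1) ^ 2) hn
  have h01 : ∀ n : ℕ, 2 ≤ n → 0 ≤ twinPartial n ∧ twinPartial n ≤ 1 := by
    intro n hn
    induction n, hn using Nat.le_induction with
    | base => simp [twinPartial]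
    | succ n hn ih =>
      obtain ⟨h1, h2⟩ := hfac n hn
      have hn2 : (2 : ℝ) ≤ n := by exact_mod_cast hn
      have h3 : 1 / (n : ℝ) ^ 2 ≤ 1 := by
        rw [div_le_one (by positivity)]
        nlinarith
      have h4 := (sub_nonneg.2 h3).trans h1
      rw [hsucc n hn]
      exact ⟨mul_nonneg ih.1 h4, mul_le_one₀ ih.2 h4 h2⟩
  have hlim := (tendsto_add_atTop_iff_nat 2).2 tendsto_twinPartial
  have hanti : Antitone fun n ↦ twinPartial (n + 2) := antitone_nat_of_succ_le fun n ↦ by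
    have := hsucc (n + 2) (by omega)
    rw [show n + 1 + 2 = n + 2 + 1 by ring, this]
    exact mul_le_of_le_one_right (h01 _ (by omega)).1 (hfac _ (by omega)).2
  have hmono : Monotone fun n : ℕ ↦ twinPartial (n + 2) * (1 - 1 / ((n + 2 : ℕ) : ℝ)) := by
    refine monotone_nat_of_le_succ fun n ↦ ?_
    have h := hsucc (n + 2) (by omega)
    have h1 := (hfac (n + 2) (by omega)).1
    simp only [show n + 1 + 2 = n + 2 + 1 by ring]
    rw [h, mul_assoc]
    refine mul_le_mul_of_nonneg_left ?_ (h01 _ (by omega)).1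
    have hm2 : (2 : ℝ) ≤ ((n + 2 : ℕ) : ℝ) := by exact_mod_cast (by omega : 2 ≤ n + 2)
    have hq : 0 ≤ 1 - 1 / ((n + 2 + 1 : ℕ) : ℝ) := by
      rw [sub_nonneg, div_le_one (by positivity)]
      push_cast at hm2 ⊢
      linarith
    refine le_trans (le_of_eq ?_) (mul_le_mul_of_nonneg_right h1 hq)
    push_cast
    field_simp
    ring
  have hlim' : Tendsto (fun n : ℕ ↦ twinPartial (n + 2) * (1 - 1 / ((n + 2 : ℕ) : ℝ))) atTop
      (𝓝 C2) := by
    have : Tendsto (fun n : ℕ ↦ 1 / ((n + 2 : ℕ) : ℝ)) atTop (𝓝 0) :=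
      (tendsto_natCast_atTop_atTop.comp (tendsto_add_atTop_nat 2)).const_div_atTop 1
    simpa using hlim.mul (this.const_sub 1)
  obtain ⟨n, rfl⟩ := Nat.exists_eq_add_of_le' hN
  have h1 := hanti.le_of_tendsto hlim n
  have h2 := hmono.ge_of_tendsto hlim' n
  obtain ⟨h3, h4⟩ := h01 _ hN
  refine ⟨h3, h4, ?_⟩
  have h5 : 0 ≤ 1 / ((n + 2 : ℕ) : ℝ) := by positivity
  have h6 := mul_le_mul_of_nonneg_right h4 h5
  rw [abs_le]
  constructor <;> linarith

lemma half_mul_prod_eq {N : ℕ} (hN : 2 ≤ N) :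
    (1 - 1 / 2 : ℝ) * ∏ p ∈ (Finset.Icc 3 N).filter Nat.Prime, (1 - 2 / (p : ℝ)) =
      2 * twinPartial N * exp (-2 * primeSum N) := by
  induction N, hN using Nat.le_induction with
  | base =>
    have : exp (-2 * primeSum 2) = 1 / 4 := by
      have h : -2 * primeSum 2 = log (1 / 4) := by
        rw [show (1 / 4 : ℝ) = (1 - 1 / 2) ^ 2 by norm_num, log_pow]
        simp [primeSum, sum_range_succ, primeWeight, Nat.prime_two, Nat.not_prime_zero,
          Nat.not_prime_one]
      rw [h, exp_log (by norm_num)]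
    rw [this]
    simp [twinPartial]
    norm_num
  | succ N hN ih =>
    have hS : primeSum (N + 1) = primeSum N + primeWeight (N + 1) := sum_range_succ _ _
    rw [prod_filter_prime_Icc_succ _ hN, ← mul_assoc, ih, twinPartial, twinPartial,
      prod_filter_prime_Icc_succ (fun n : ℕ ↦ (n : ℝ) * ((n : ℝ) - 2) / ((n : ℝ) - 1) ^ 2) hN, hS,
      mul_add, exp_add]
    by_cases hp : (N + 1).Prime
    · have hN2 : (2 : ℝ) ≤ N := by exact_mod_cast hN
      have hpos : 0 < 1 - 1 / ((N + 1 : ℕ) : ℝ) := by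
        rw [sub_pos, div_lt_one (by positivity)]
        push_cast
        linarith
      have he : exp (-2 * primeWeight (N + 1)) = (1 - 1 / ((N + 1 : ℕ) : ℝ)) ^ 2 := by
        rw [primeWeight, if_pos hp, neg_mul_neg, ← exp_log (pow_pos hpos 2), log_pow]
        norm_num
      rw [he, if_pos hp, if_pos hp]
      push_cast
      rw [add_sub_cancel_right]
      field_simp
      ring
    · simp [hp, primeWeight]

end Mertens

open Mertens in
/-- as `x → ∞`,
`(1 - 1/2) ∏_{2 < p ≤ x} (1 - 2/p) = 2C₂ e^{-2γ}/(ln x)² + O(1/(ln x)³)`. -/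
theorem mertens_type_product_asymptotic :
    (fun x : ℝ =>
        (1 - 1 / 2 : ℝ) *
            (∏ p ∈ (Finset.Icc 3 ⌊x⌋₊).filter Nat.Prime, (1 - 2 / (p : ℝ))) -
          2 * C2 * Real.exp (-2 * Real.eulerMascheroniConstant) / (Real.log x) ^ 2)
      =O[atTop] fun x : ℝ => 1 / (Real.log x) ^ 3 := by
  obtain ⟨K, hK⟩ := exists_abs_primeSum_floor_sub_le
  refine Asymptotics.IsBigO.of_bound
    (2 * exp (-2 * eulerMascheroniConstant) * (4 * K + 2)) ?_
  filter_upwards [eventually_ge_atTop 3, tendsto_log_atTop.eventually_ge_atTop (2 * K)]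
    with x hx hKx
  have hN : 3 ≤ ⌊x⌋₊ := Nat.le_floor (by exact_mod_cast hx)
  have hN3 : (3 : ℝ) ≤ ⌊x⌋₊ := by exact_mod_cast hN
  have hE := hK x hx
  obtain ⟨hT0, hT1, hT⟩ := twinPartial_bounds (show 2 ≤ ⌊x⌋₊ by omega)
  set T := twinPartial ⌊x⌋₊
  set γ := eulerMascheroniConstant
  set E := primeSum ⌊x⌋₊ - log (log x) - γ with hEdef
  have hL : 0 < log x := log_pos (by linarith)
  have hexp : exp (-2 * primeSum ⌊x⌋₊) = exp (-2 * γ) / log x ^ 2 * exp (-2 * E) := by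
    have h1 : -2 * primeSum ⌊x⌋₊ = -2 * γ + -2 * E - log (log x ^ 2) := by
      rw [log_pow, hEdef]
      push_cast
      ring
    rw [h1, exp_sub, exp_add, exp_log (by positivity)]
    ring
  have hE2 : |-2 * E| = 2 * |E| := by rw [abs_mul]; norm_num
  have hKL : K / log x ≤ 1 / 2 := by rw [div_le_iff₀ hL]; linarith
  have hexpE : |exp (-2 * E) - 1| ≤ 4 * K / log x := by
    have h := abs_exp_sub_one_le (x := -2 * E) (by rw [hE2]; linarith)
    rw [hE2] at h
    rw [mul_div_assoc]
    linarith
  have hNL : 1 / (⌊x⌋₊ : ℝ) ≤ 2 / log x := by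
    rw [div_le_div_iff₀ (by linarith) hL]
    linarith [log_le_sub_one_of_pos (show 0 < x by linarith), Nat.lt_floor_add_one x]
  have hmain : |T * exp (-2 * E) - C2| ≤ (4 * K + 2) / log x := by
    have e : T * exp (-2 * E) - C2 = T * (exp (-2 * E) - 1) + (T - C2) := by ring
    rw [e, add_div]
    refine (abs_add_le _ _).trans (add_le_add ?_ (hT.trans hNL))
    rw [abs_mul, abs_of_nonneg hT0]
    exact (mul_le_of_le_one_left (abs_nonneg _) hT1).trans hexpE
  rw [half_mul_prod_eq (by omega), hexp]
  have e : 2 * T * (exp (-2 * γ) / log x ^ 2 * exp (-2 * E)) -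
      2 * C2 * exp (-2 * γ) / log x ^ 2 =
      2 * exp (-2 * γ) / log x ^ 2 * (T * exp (-2 * E) - C2) := by ring
  rw [e, norm_mul, norm_eq_abs, norm_eq_abs, norm_eq_abs, abs_of_pos (by positivity),
    abs_of_pos (show 0 < 1 / log x ^ 3 by positivity)]
  calc 2 * exp (-2 * γ) / log x ^ 2 * |T * exp (-2 * E) - C2|
      ≤ 2 * exp (-2 * γ) / log x ^ 2 * ((4 * K + 2) / log x) := by gcongr
    _ = 2 * exp (-2 * γ) * (4 * K + 2) * (1 / log x ^ 3) := by field_simp
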